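/- arXiv:2109.05655 — 2 statements merged into one kernel-verified Lean document; each statement's English description precedes it below -/
import Mathlib

section
/- Let n ≥ 0 and let C be an element of the n-qubit real Clifford group C_n. If C P C⁻¹ = P for every P in the n-qubit real Pauli group P_n, then C = I or C = −I (where I is the 2^n × 2^n identity matrix). -/
open Matrix

noncomputable section

namespace RealStab

abbrev Mat (n : ℕ) := Matrix (Fin n → Fin 2) (Fin n → Fin 2) ℝ

/-- The real Pauli matrix `X`. -/
def X2 : Matrix (Fin 2) (Fin 2) ℝ := !![0, 1; 1, 0]

/-- The real Pauli matrix `Z`. -/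
def Z2 : Matrix (Fin 2) (Fin 2) ℝ := !![1, 0; 0, -1]

/-- The set `{I, X, Z, XZ}` of single-qubit Pauli matrices. -/
def pauliSet : Set (Matrix (Fin 2) (Fin 2) ℝ) := {1, X2, Z2, X2 * Z2}

/-- The `n`-fold Kronecker (tensor) product `P 0 ⊗ ⋯ ⊗ P (n-1)`, represented as a
matrix indexed by functions `Fin n → Fin 2` (a `2^n × 2^n` matrix). -/
def tensorN {n : ℕ} (P : Fin n → Matrix (Fin 2) (Fin 2) ℝ) : Mat n :=
  Matrix.of fun x y => ∏ i, P i (x i) (y i)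

/-- The `n`-qubit real Pauli group `P_n`, as a set of `2^n × 2^n` real matrices. -/
def PauliGroup (n : ℕ) : Set (Mat n) :=
  { M | ∃ a : Fin 2, ∃ P : Fin n → Matrix (Fin 2) (Fin 2) ℝ,
      (∀ i, P i ∈ pauliSet) ∧ M = (-1 : ℝ) ^ (a : ℕ) • tensorN P }


/-- The `n`-qubit real Clifford group `C_n`: orthogonal matrices normalizing `P_n`. -/
def CliffordGroup (n : ℕ) : Set (Mat n) :=
  { U | U ∈ Matrix.orthogonalGroup (Fin n → Fin 2) ℝ ∧
        ∀ P ∈ PauliGroup n, U * P * U⁻¹ ∈ PauliGroup n }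

theorem tensorN_diagonal {n : ℕ} (d : Fin n → Fin 2 → ℝ) :
    tensorN (fun i => diagonal (d i)) = diagonal fun x => ∏ i, d i (x i) := by
  ext x y
  by_cases hxy : x = y
  · subst hxy
    simp [tensorN]
  · obtain ⟨i, hi⟩ := Function.ne_iff.mp hxy
    rw [diagonal_apply_ne _ hxy]
    exact Finset.prod_eq_zero (Finset.mem_univ i) (diagonal_apply_ne _ hi)

theorem Z2_eq_diagonal : Z2 = diagonal ![1, -1] := by
  ext i j
  fin_cases i <;> fin_cases j <;> simp [Z2]

theorem tensorN_mem_PauliGroup {n : ℕ} {P : Fin n → Matrix (Fin 2) (Fin 2) ℝ}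
    (hP : ∀ i, P i ∈ pauliSet) : tensorN P ∈ PauliGroup n :=
  ⟨0, P, hP, by simp⟩

/-- The Pauli matrix acting as `Z` on the qubit `i` and trivially elsewhere. -/
theorem diagonal_sign_mem_PauliGroup {n : ℕ} (i : Fin n) :
    diagonal (fun x : Fin n → Fin 2 => (![1, -1] : Fin 2 → ℝ) (x i)) ∈ PauliGroup n := by
  have key : diagonal (fun x : Fin n → Fin 2 => (![1, -1] : Fin 2 → ℝ) (x i)) =
      tensorN fun j => diagonal (if j = i then ![1, -1] else 1) := by
    rw [tensorN_diagonal]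
    congr 1
    ext x
    rw [Finset.prod_eq_single i (fun j _ hj => by simp [hj]) (by simp)]
    simp
  rw [key]
  refine tensorN_mem_PauliGroup fun j => ?_
  by_cases hj : j = i
  · simp [hj, pauliSet, Z2_eq_diagonal]
  · simp [hj, pauliSet]

theorem exists_mem_PauliGroup_apply_eq_one {n : ℕ} (x y : Fin n → Fin 2) :
    ∃ T ∈ PauliGroup n, T x y = 1 := by
  refine ⟨tensorN fun i => if x i = y i then 1 else X2, tensorN_mem_PauliGroup fun i => ?_, ?_⟩
  · by_cases h : x i = y i <;> simp [h, pauliSet]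
  · rw [tensorN, of_apply]
    refine Finset.prod_eq_one fun i _ => ?_
    generalize x i = a
    generalize y i = b
    fin_cases a <;> fin_cases b <;> simp [X2]

/-- The commutant of the real Pauli group consists of scalar matrices. -/
theorem exists_eq_smul_one_of_commute {n : ℕ} {C : Mat n}
    (h : ∀ P ∈ PauliGroup n, C * P = P * C) : ∃ c : ℝ, C = c • (1 : Mat n) := by
  have hoff : ∀ x y, x ≠ y → C x y = 0 := by
    intro x y hxy
    obtain ⟨i, hi⟩ := Function.ne_iff.mp hxy
    have e := congrFun₂ (h _ (diagonal_sign_mem_PauliGroup i)) x y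
    rw [mul_diagonal, diagonal_mul] at e
    revert hi e
    generalize x i = a
    generalize y i = b
    fin_cases a <;> fin_cases b <;> simp <;> intro e <;> linarith
  have hC : C = diagonal fun x => C x x := by
    ext x y
    by_cases hxy : x = y
    · subst hxy
      simp
    · rw [diagonal_apply_ne _ hxy, hoff x y hxy]
  refine ⟨C 0 0, ?_⟩
  rw [hC, smul_one_eq_diagonal]
  congr 1
  ext x
  obtain ⟨T, hT, hxy⟩ := exists_mem_PauliGroup_apply_eq_one x 0
  have e := congrFun₂ (h T hT) x 0
  rw [hC, mul_diagonal, diagonal_mul, hxy] at e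
  simpa using e

/-- If `C ∈ C_n` satisfies `C P C⁻¹ = P` for every `P ∈ P_n`,
then `C = I` or `C = −I`. -/
theorem clifford_central_iff_pm_one (n : ℕ) (C : Mat n) (hC : C ∈ CliffordGroup n)
    (h : ∀ P ∈ PauliGroup n, C * P * C⁻¹ = P) :
    C = 1 ∨ C = -1 := by
  obtain ⟨hO, -⟩ := hC
  have hCC : C * Cᵀ = 1 := (mem_orthogonalGroup_iff _ _).mp hO
  have hdet : IsUnit C.det := isUnit_det_of_right_inverse hCC
  obtain ⟨c, rfl⟩ := exists_eq_smul_one_of_commute (C := C) fun P hP => by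
    nth_rewrite 2 [← h P hP]
    rw [nonsing_inv_mul_cancel_right _ _ hdet]
  have hc : c * c = 1 := by simpa using congrFun₂ hCC 0 0
  rcases mul_self_eq_one_iff.mp hc with rfl | rfl
  · exact Or.inl (one_smul _ _)
  · exact Or.inr (by simp)

end RealStab

end
end

section
/- Let n ≥ 1 and let P be an element of the n-qubit real Pauli group P_n with P² = I, P ≠ I, and P ≠ −I. Then there exists U in the gate group G_n such that U P U⁻¹ = Z ⊗ I ⊗ ⋯ ⊗ I (the matrix with Z in the first tensor factor and the 2×2 identity in the remaining n−1 factors). -/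
open Matrix

noncomputable section

namespace RealStab

/-- The Hadamard matrix `H = (1/√2)·!![1,1;1,−1]`. -/
def Hmat : Matrix (Fin 2) (Fin 2) ℝ := (Real.sqrt 2)⁻¹ • !![1, 1; 1, -1]

/-- The single-qubit gate `G` applied on qubit `i`: the Kronecker product
`I^{⊗(i-1)} ⊗ G ⊗ I^{⊗(n-i)}`. -/
def gate1 {n : ℕ} (i : Fin n) (G : Matrix (Fin 2) (Fin 2) ℝ) : Mat n :=
  tensorN (fun j => if j = i then G else 1)

/-- The controlled-Z gate on qubits `i` and `j`: diagonal, with entry `−1` exactly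
on basis states where both bits `i` and `j` equal `1`. For `j = i+1` this is
`I^{⊗(i-1)} ⊗ CZ ⊗ I^{⊗(n-i-1)}` with `CZ = diag(1,1,1,−1)`. -/
def CZgate {n : ℕ} (i j : Fin n) : Mat n :=
  Matrix.diagonal (fun x => if x i = 1 ∧ x j = 1 then -1 else 1)

/-- The set of generating gate matrices: `H`-gates and `Z`-gates on each qubit, and
`CZ`-gates on adjacent pairs of qubits. -/
def gateSet (n : ℕ) : Set (Mat n) :=
  { M | (∃ i : Fin n, M = gate1 i Hmat) ∨ (∃ i : Fin n, M = gate1 i Z2) ∨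
        (∃ i : Fin n, ∃ h : (i : ℕ) + 1 < n, M = CZgate i ⟨(i : ℕ) + 1, h⟩) }

/-- The gate group `G_n`: the subgroup of `GL(2^n, ℝ)` (units of the matrix ring)
generated by all `H`-gates, `Z`-gates and `CZ`-gates. -/
def GateGroup (n : ℕ) : Subgroup (Mat n)ˣ :=
  Subgroup.closure { U : (Mat n)ˣ | (U : Mat n) ∈ gateSet n }

/-- The extended gate group `G_n'`: the subgroup of `GL(2^n, ℝ)` generated by `−I`
together with all `H`-gates, `Z`-gates and `CZ`-gates. -/
def ExtGateGroup (n : ℕ) : Subgroup (Mat n)ˣ :=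
  Subgroup.closure ({ U : (Mat n)ˣ | (U : Mat n) ∈ gateSet n } ∪ {(-1 : (Mat n)ˣ)})

lemma Hmat_mul_self : Hmat * Hmat = 1 := by
  have h : (√2)⁻¹ * (√2)⁻¹ = (2 : ℝ)⁻¹ := by
    rw [← mul_inv, Real.mul_self_sqrt zero_le_two]
  rw [Hmat, smul_mul_smul_comm, h]
  ext a b
  fin_cases a <;> fin_cases b <;> norm_num [Matrix.mul_apply, Fin.sum_univ_two]

lemma Z2_mul_self : Z2 * Z2 = 1 := by
  ext a b
  fin_cases a <;> fin_cases b <;> simp [Z2, Matrix.mul_apply, Fin.sum_univ_two]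

lemma Hmat_mul_X2 : Hmat * X2 = Z2 * Hmat := by
  ext a b
  fin_cases a <;> fin_cases b <;>
    simp [Hmat, X2, Z2, Matrix.mul_apply, Fin.sum_univ_two]

lemma Hmat_mul_Z2 : Hmat * Z2 = X2 * Hmat := by
  ext a b
  fin_cases a <;> fin_cases b <;>
    simp [Hmat, X2, Z2, Matrix.mul_apply, Fin.sum_univ_two]

lemma Z2_mul_X2 : Z2 * X2 = -(X2 * Z2) := by
  ext a b
  fin_cases a <;> fin_cases b <;> simp [X2, Z2, Matrix.mul_apply, Fin.sum_univ_two]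

lemma X2_mul_Z2_mul_self : X2 * Z2 * (X2 * Z2) = -1 := by
  ext a b
  fin_cases a <;> fin_cases b <;> simp [X2, Z2, Matrix.mul_apply, Fin.sum_univ_two]

lemma tensorN_mul {n : ℕ} (F G : Fin n → Matrix (Fin 2) (Fin 2) ℝ) :
    tensorN F * tensorN G = tensorN (F * G) := by
  ext x y
  simp only [tensorN, Matrix.mul_apply, Matrix.of_apply, Pi.mul_apply,
    ← Finset.prod_mul_distrib]
  rw [Finset.prod_univ_sum, Fintype.piFinset_univ]

lemma tensorN_one {n : ℕ} : tensorN (1 : Fin n → Matrix (Fin 2) (Fin 2) ℝ) = 1 := by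
  ext x y
  by_cases h : x = y
  · subst h; simp [tensorN]
  · obtain ⟨i, hi⟩ := Function.ne_iff.mp h
    rw [Matrix.one_apply_ne h]
    exact Finset.prod_eq_zero (Finset.mem_univ i) (Matrix.one_apply_ne hi)

lemma gate1_eq {n : ℕ} (i : Fin n) (G : Matrix (Fin 2) (Fin 2) ℝ) :
    gate1 i G = tensorN (Function.update 1 i G) := by
  unfold gate1
  congr 1
  ext1 j
  by_cases h : j = i
  · subst h; simp
  · simp [h]

lemma gate1_mul_gate1 {n : ℕ} (i : Fin n) (A B : Matrix (Fin 2) (Fin 2) ℝ) :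
    gate1 i A * gate1 i B = gate1 i (A * B) := by
  simp only [gate1_eq, tensorN_mul, ← Function.update_mul, one_mul]

lemma gate1_one {n : ℕ} (i : Fin n) : gate1 i 1 = 1 := by
  simp [gate1, ← tensorN_one, Pi.one_def]

lemma gate1_neg {n : ℕ} (i : Fin n) (A : Matrix (Fin 2) (Fin 2) ℝ) :
    gate1 i (-A) = -gate1 i A := by
  ext x y
  simp only [gate1, tensorN, Matrix.of_apply, Matrix.neg_apply]
  rw [← Finset.mul_prod_erase _ _ (Finset.mem_univ i),
    ← Finset.mul_prod_erase _ _ (Finset.mem_univ i), if_pos rfl, if_pos rfl, Matrix.neg_apply,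
    neg_mul]
  congr 2
  refine Finset.prod_congr rfl fun j hj => ?_
  rw [if_neg (Finset.ne_of_mem_erase hj), if_neg (Finset.ne_of_mem_erase hj)]

lemma gate1_mul_tensorN_update {n : ℕ} (i : Fin n) {G A B : Matrix (Fin 2) (Fin 2) ℝ}
    (F : Fin n → Matrix (Fin 2) (Fin 2) ℝ) (h : G * A = B * G) :
    gate1 i G * tensorN (Function.update F i A) =
      tensorN (Function.update F i B) * gate1 i G := by
  simp only [gate1_eq, tensorN_mul, ← Function.update_mul, one_mul, mul_one, h]

lemma CZgate_mul_self {n : ℕ} (i j : Fin n) : CZgate i j * CZgate i j = 1 := by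
  rw [CZgate, Matrix.diagonal_mul_diagonal, ← Matrix.diagonal_one]
  congr 1
  ext x
  split_ifs <;> simp

lemma tensorN_update_update_apply {n : ℕ} {i j : Fin n} (hij : i ≠ j)
    (F : Fin n → Matrix (Fin 2) (Fin 2) ℝ) (A B : Matrix (Fin 2) (Fin 2) ℝ)
    (x y : Fin n → Fin 2) :
    tensorN (Function.update (Function.update F i A) j B) x y =
      A (x i) (y i) * B (x j) (y j) *
        ∏ k ∈ (Finset.univ.erase j).erase i, F k (x k) (y k) := by
  rw [tensorN, Matrix.of_apply, ← Finset.mul_prod_erase _ _ (Finset.mem_univ j),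
    ← Finset.mul_prod_erase _ _ (Finset.mem_erase.mpr ⟨hij, Finset.mem_univ i⟩)]
  have h : ∀ k ∈ (Finset.univ.erase j).erase i,
      Function.update (Function.update F i A) j B k (x k) (y k) = F k (x k) (y k) := by
    intro k hk
    simp only [Finset.mem_erase] at hk
    simp [hk.1, hk.2.1]
  rw [Finset.prod_congr rfl h]
  simp [hij]
  ring

/-- The diagonal entries of the two-qubit `CZ` gate. -/
def czSign (a b : Fin 2) : ℝ := if a = 1 ∧ b = 1 then -1 else 1

lemma CZgate_mul_tensorN_update {n : ℕ} {i j : Fin n} (hij : i ≠ j)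
    (F : Fin n → Matrix (Fin 2) (Fin 2) ℝ) {A B A' B' : Matrix (Fin 2) (Fin 2) ℝ} {s : ℝ}
    (h : ∀ a b c d, czSign a c * (A a b * B c d) = s * (A' a b * B' c d * czSign b d)) :
    CZgate i j * tensorN (Function.update (Function.update F i A) j B) =
      s • (tensorN (Function.update (Function.update F i A') j B') * CZgate i j) := by
  ext x y
  rw [CZgate, Matrix.diagonal_mul, Matrix.smul_apply, Matrix.mul_diagonal,
    tensorN_update_update_apply hij, tensorN_update_update_apply hij, smul_eq_mul]
  have := h (x i) (y i) (x j) (y j)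
  simp only [czSign] at this
  linear_combination
    (∏ k ∈ (Finset.univ.erase j).erase i, F k (x k) (y k)) * this

/-- Conjugacy under the gate group, up to sign. -/
def GateSim {n : ℕ} (P Q : Mat n) : Prop :=
  ∃ U ∈ GateGroup n, ∃ s : ℝ, s * s = 1 ∧ (U : Mat n) * P = s • (Q * U)

namespace GateSim

variable {n : ℕ} {P Q R : Mat n}

lemma refl (P : Mat n) : GateSim P P :=
  ⟨1, one_mem _, 1, one_mul 1, by simp⟩

lemma trans (h : GateSim P Q) (h' : GateSim Q R) : GateSim P R := by
  obtain ⟨U, hU, s, hs, h⟩ := h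
  obtain ⟨V, hV, t, ht, h'⟩ := h'
  refine ⟨V * U, mul_mem hV hU, s * t, by linear_combination t * t * hs + ht, ?_⟩
  rw [Units.val_mul, mul_assoc, h, mul_smul_comm, ← mul_assoc, h', smul_mul_assoc, smul_smul,
    mul_assoc]

lemma symm (h : GateSim P Q) : GateSim Q P := by
  obtain ⟨U, hU, s, hs, h⟩ := h
  refine ⟨U⁻¹, inv_mem hU, s, hs, ?_⟩
  rw [Units.inv_mul_eq_iff_eq_mul, mul_smul_comm, ← mul_assoc, h, smul_mul_assoc, smul_smul, hs,
    one_smul, Units.mul_inv_cancel_right]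

end GateSim

/-- An involutive generating gate, as an element of the group of units. -/
lemma exists_unit_mem_GateGroup {n : ℕ} {M : Mat n} (hM : M ∈ gateSet n) (h : M * M = 1) :
    ∃ U ∈ GateGroup n, (U : Mat n) = M :=
  ⟨⟨M, M, h, h⟩, Subgroup.subset_closure hM, rfl⟩

lemma gate1_Hmat_mul_self {n : ℕ} (i : Fin n) : gate1 i Hmat * gate1 i Hmat = 1 := by
  rw [gate1_mul_gate1, Hmat_mul_self, gate1_one]

lemma gate1_Z2_mul_self {n : ℕ} (i : Fin n) : gate1 i Z2 * gate1 i Z2 = 1 := by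
  rw [gate1_mul_gate1, Z2_mul_self, gate1_one]

lemma gateSim_update_X2_Z2 {n : ℕ} (F : Fin n → Matrix (Fin 2) (Fin 2) ℝ) (i : Fin n) :
    GateSim (tensorN (Function.update F i X2)) (tensorN (Function.update F i Z2)) := by
  obtain ⟨U, hU, hUM⟩ :=
    exists_unit_mem_GateGroup (Or.inl ⟨i, rfl⟩) (gate1_Hmat_mul_self i)
  refine ⟨U, hU, 1, one_mul 1, ?_⟩
  rw [hUM, one_smul, gate1_mul_tensorN_update i F Hmat_mul_X2]

lemma gateSim_update_CZ {n : ℕ} (F : Fin n → Matrix (Fin 2) (Fin 2) ℝ) {i j : Fin n}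
    (hij : (i : ℕ) + 1 = j) {A B A' B' : Matrix (Fin 2) (Fin 2) ℝ} (s : ℝ) (hs : s * s = 1)
    (h : ∀ a b c d, czSign a c * (A a b * B c d) = s * (A' a b * B' c d * czSign b d)) :
    GateSim (tensorN (Function.update (Function.update F i A) j B))
      (tensorN (Function.update (Function.update F i A') j B')) := by
  have hj : j = ⟨(i : ℕ) + 1, hij ▸ j.isLt⟩ := Fin.ext hij.symm
  obtain ⟨U, hU, hUM⟩ := exists_unit_mem_GateGroup
    (Or.inr (Or.inr ⟨i, hij ▸ j.isLt, congrArg (CZgate i) hj⟩)) (CZgate_mul_self i j)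
  refine ⟨U, hU, s, hs, ?_⟩
  rw [hUM]
  exact CZgate_mul_tensorN_update (by rintro rfl; omega) F h

/-- A Pauli operator on two adjacent qubits can be moved onto the first of them. -/
lemma exists_gateSim_update_one {n : ℕ} (F : Fin n → Matrix (Fin 2) (Fin 2) ℝ) {i j : Fin n}
    (hij : (i : ℕ) + 1 = j) {A B : Matrix (Fin 2) (Fin 2) ℝ} (hA : A ∈ pauliSet)
    (hB : B ∈ pauliSet) :
    ∃ C ∈ pauliSet, GateSim (tensorN (Function.update (Function.update F i A) j B))
      (tensorN (Function.update (Function.update F i C) j 1)) := by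
  have hne : i ≠ j := by rintro rfl; omega
  set S : Matrix (Fin 2) (Fin 2) ℝ → Matrix (Fin 2) (Fin 2) ℝ →
      Matrix (Fin 2) (Fin 2) ℝ → Matrix (Fin 2) (Fin 2) ℝ → Prop := fun A B A' B' =>
    GateSim (tensorN (Function.update (Function.update F i A) j B))
      (tensorN (Function.update (Function.update F i A') j B')) with hS
  have right (A) : S A X2 A Z2 := gateSim_update_X2_Z2 _ j
  have left (B) : S X2 B Z2 B := by
    simp only [hS, Function.update_comm hne]
    exact gateSim_update_X2_Z2 _ i
  have XZ : S X2 Z2 X2 1 := by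
    refine gateSim_update_CZ F hij 1 (by norm_num) ?_
    simp [Fin.forall_fin_two, czSign, X2, Z2]
  have IX : S 1 X2 Z2 X2 := by
    refine gateSim_update_CZ F hij 1 (by norm_num) ?_
    simp [Fin.forall_fin_two, czSign, X2, Z2]
  have YZ : S (X2 * Z2) Z2 (X2 * Z2) 1 := by
    refine gateSim_update_CZ F hij 1 (by norm_num) ?_
    simp [Fin.forall_fin_two, czSign, X2, Z2]
  have IY : S 1 (X2 * Z2) Z2 (X2 * Z2) := by
    refine gateSim_update_CZ F hij 1 (by norm_num) ?_
    simp [Fin.forall_fin_two, czSign, X2, Z2]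
  have YY : S (X2 * Z2) (X2 * Z2) X2 X2 := by
    refine gateSim_update_CZ F hij (-1) (by norm_num) ?_
    simp [Fin.forall_fin_two, czSign, X2, Z2]
  have XY : S X2 (X2 * Z2) (X2 * Z2) X2 := by
    refine gateSim_update_CZ F hij (-1) (by norm_num) ?_
    simp [Fin.forall_fin_two, czSign, X2, Z2]
  have XX : S X2 X2 X2 1 := (right X2).trans XZ
  have ZX : S Z2 X2 X2 1 := (left X2).symm.trans XX
  have YX : S (X2 * Z2) X2 (X2 * Z2) 1 := (right _).trans YZ
  have ZY : S Z2 (X2 * Z2) (X2 * Z2) 1 := (left _).symm.trans (XY.trans YX)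
  have memX : X2 ∈ pauliSet := by simp [pauliSet]
  have memY : X2 * Z2 ∈ pauliSet := by simp [pauliSet]
  have onX (A) (hA : A ∈ pauliSet) : ∃ C ∈ pauliSet, S A X2 C 1 := by
    rcases hA with rfl | rfl | rfl | rfl
    exacts [⟨X2, memX, IX.trans ZX⟩, ⟨X2, memX, XX⟩, ⟨X2, memX, ZX⟩, ⟨_, memY, YX⟩]
  rcases hB with rfl | rfl | rfl | rfl
  · exact ⟨A, hA, GateSim.refl _⟩
  · exact onX A hA
  · obtain ⟨C, hC, h⟩ := onX A hA
    exact ⟨C, hC, (right A).symm.trans h⟩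
  · rcases hA with rfl | rfl | rfl | rfl
    exacts [⟨_, memY, IY.trans ZY⟩, ⟨_, memY, XY.trans YX⟩, ⟨_, memY, ZY⟩,
      ⟨_, memX, YY.trans XX⟩]

lemma exists_gateSim_gate1 {n : ℕ} (i₀ : Fin n) (hi₀ : (i₀ : ℕ) = 0) (m : ℕ)
    (F : Fin n → Matrix (Fin 2) (Fin 2) ℝ) (hF : ∀ i, F i ∈ pauliSet)
    (hm : ∀ i : Fin n, m < i → F i = 1) :
    ∃ C ∈ pauliSet, GateSim (tensorN F) (gate1 i₀ C) := by
  induction m generalizing F with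
  | zero =>
    refine ⟨F i₀, hF i₀, ?_⟩
    have hF' : F = Function.update (1 : Fin n → Matrix (Fin 2) (Fin 2) ℝ) i₀ (F i₀) := by
      rw [Function.eq_update_iff]
      exact ⟨rfl, fun i hi => hm i (by
        have := Fin.val_ne_of_ne hi
        omega)⟩
    rw [gate1_eq, ← hF']
    exact GateSim.refl _
  | succ m ih =>
    by_cases hmn : m + 1 < n
    · set j : Fin n := ⟨m + 1, hmn⟩
      set i : Fin n := ⟨m, by omega⟩ with hi
      obtain ⟨C, hC, h⟩ := exists_gateSim_update_one F (i := i) (j := j) rfl (hF i) (hF j)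
      rw [Function.update_eq_self, Function.update_eq_self] at h
      obtain ⟨D, hD, h'⟩ := ih (Function.update (Function.update F i C) j 1)
        (fun k => by
          simp only [Function.update_apply]
          split_ifs
          exacts [by simp [pauliSet], hC, hF k])
        (fun k hk => by
          by_cases hkj : k = j
          · simp [hkj]
          · have hki : k ≠ i := by rintro rfl; simp [hi] at hk
            rw [Function.update_of_ne hkj, Function.update_of_ne hki]
            refine hm k ?_
            have : (k : ℕ) ≠ m + 1 := fun h => hkj (Fin.ext h)
            omega)
      exact ⟨D, hD, h.trans h'⟩
    · exact ih F hF fun i hi => hm i (by omega)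

lemma exists_mem_GateGroup_mul_gate1_Z2 {n : ℕ} (i : Fin n) :
    ∃ V ∈ GateGroup n, (V : Mat n) * gate1 i Z2 = -(gate1 i Z2 * V) := by
  obtain ⟨U, hU, hUM⟩ :=
    exists_unit_mem_GateGroup (Or.inl ⟨i, rfl⟩) (gate1_Hmat_mul_self i)
  obtain ⟨W, hW, hWM⟩ :=
    exists_unit_mem_GateGroup (Or.inr (Or.inl ⟨i, rfl⟩)) (gate1_Z2_mul_self i)
  refine ⟨U * W * U, mul_mem (mul_mem hU hW) hU, ?_⟩
  have h : Hmat * Z2 * Hmat = X2 := by rw [Hmat_mul_Z2, mul_assoc, Hmat_mul_self, mul_one]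
  simp only [Units.val_mul, hUM, hWM, gate1_mul_gate1, h, Z2_mul_X2, gate1_neg, neg_neg]


/-- For `n ≥ 1` and `P ∈ P_n` with `P² = I`, `P ≠ ±I`, there is a
`U` in the gate group `G_n` with `U P U⁻¹ = Z ⊗ I ⊗ ⋯ ⊗ I`. -/
theorem exists_gate_conj_to_firstZ (n : ℕ) (hn : 1 ≤ n) (P : Mat n)
    (hP : P ∈ PauliGroup n) (hP2 : P * P = 1) (h1 : P ≠ 1) (hm1 : P ≠ -1) :
    ∃ U ∈ GateGroup n,
      (U : Mat n) * P * ((U⁻¹ : (Mat n)ˣ) : Mat n) =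
        tensorN (fun j => if (j : ℕ) = 0 then Z2 else 1) := by
  obtain ⟨a, F, hF, rfl⟩ := hP
  set P := (-1 : ℝ) ^ (a : ℕ) • tensorN F with hP
  set i₀ : Fin n := ⟨0, hn⟩
  obtain ⟨C, hC, hFC⟩ :=
    exists_gateSim_gate1 i₀ rfl n F hF fun i hi => absurd i.isLt (by omega)
  have hPF : GateSim P (tensorN F) :=
    ⟨1, one_mem _, (-1) ^ (a : ℕ), by rw [← mul_pow]; simp, by simp [hP]⟩
  have hPC := hPF.trans hFC
  have hZ : GateSim P (gate1 i₀ Z2) := by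
    obtain ⟨U, -, s, hs, h⟩ := id hPC
    rcases hC with rfl | rfl | rfl | rfl
    · rw [gate1_one, one_mul, ← mul_one (U : Mat n), mul_assoc, one_mul, ← mul_smul_comm,
        Units.mul_right_inj] at h
      rcases mul_self_eq_one_iff.mp hs with rfl | rfl
      · exact absurd (by simpa using h) h1
      · exact absurd (by simpa using h) hm1
    · rw [gate1_eq] at hPC ⊢
      exact hPC.trans (gateSim_update_X2_Z2 1 i₀)
    · exact hPC
    · have hsq : (U : Mat n) * (P * P) = -U := by
        rw [← mul_assoc, h, smul_mul_assoc, mul_assoc, h, mul_smul_comm, smul_smul, hs, one_smul,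
          ← mul_assoc, gate1_mul_gate1, X2_mul_Z2_mul_self, gate1_neg, gate1_one, neg_one_mul]
      rw [hP2, mul_one] at hsq
      exact absurd (Matrix.ext fun x y => self_eq_neg.mp (congrFun (congrFun hsq x) y))
        U.ne_zero
  have htarget : tensorN (fun j : Fin n => if (j : ℕ) = 0 then Z2 else 1) = gate1 i₀ Z2 := by
    simp [gate1, i₀, Fin.ext_iff]
  rw [htarget]
  obtain ⟨U, hU, s, hs, h⟩ := hZ
  rcases mul_self_eq_one_iff.mp hs with rfl | rfl
  · exact ⟨U, hU, by rw [Units.mul_inv_eq_iff_eq_mul, h, one_smul]⟩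
  · obtain ⟨V, hV, hVZ⟩ := exists_mem_GateGroup_mul_gate1_Z2 i₀
    refine ⟨V * U, mul_mem hV hU, ?_⟩
    rw [Units.mul_inv_eq_iff_eq_mul, Units.val_mul, mul_assoc, h, mul_smul_comm, ← mul_assoc,
      hVZ, neg_one_smul, neg_mul, neg_neg, mul_assoc]

end RealStab

end
end
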